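/- Sign determination in the index 2 case, form (1): assume f is even and that the Gauss sum satisfies G(χ) = ε · p^{f/2} for some root of unity ε ∈ ℤ[ζ_{q−1}]. Then t(−n) · ε ≡ (−1)^{f/2 + 1} (mod 𝔓); i.e., modulo 𝔓 the root of unity ε is congruent to (−1)^{f/2+1} · t(−n)^{−1} in the residue field. -/

import Mathlib

open NumberField

/-- The digit sum `S(a) = c₀ + ⋯ + c_{f−1}` of the base-`p` expansion of `a`. -/
def digitSum (p a : ℕ) : ℕ := (Nat.digits p a).sum

/-- The product `t(a) = c₀!·c₁!·⋯·c_{f−1}!` of the factorials of the base-`p`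
digits of `a`. -/
def digitFacProd (p a : ℕ) : ℕ := ((Nat.digits p a).map Nat.factorial).prod

section Digits

variable {p : ℕ}

lemma digitSum_add_mul (hp : 1 < p) {r : ℕ} (hr : r < p) (m : ℕ) :
    digitSum p (r + p * m) = r + digitSum p m := by
  unfold digitSum
  rcases Nat.eq_zero_or_pos (r + p * m) with h | h
  · obtain ⟨rfl, hm⟩ := Nat.add_eq_zero_iff.mp h
    obtain rfl : m = 0 := (Nat.mul_eq_zero.mp hm).resolve_left (by omega)
    simp
  · rw [Nat.digits_def' hp h, Nat.add_mul_mod_self_left, Nat.mod_eq_of_lt hr,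
      Nat.add_mul_div_left _ _ (by omega), Nat.div_eq_of_lt hr]
    simp

lemma digitFacProd_add_mul (hp : 1 < p) {r : ℕ} (hr : r < p) (m : ℕ) :
    digitFacProd p (r + p * m) = r.factorial * digitFacProd p m := by
  unfold digitFacProd
  rcases Nat.eq_zero_or_pos (r + p * m) with h | h
  · obtain ⟨rfl, hm⟩ := Nat.add_eq_zero_iff.mp h
    obtain rfl : m = 0 := (Nat.mul_eq_zero.mp hm).resolve_left (by omega)
    simp
  · rw [Nat.digits_def' hp h, Nat.add_mul_mod_self_left, Nat.mod_eq_of_lt hr,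
      Nat.add_mul_div_left _ _ (by omega), Nat.div_eq_of_lt hr]
    simp

lemma not_dvd_digitFacProd (hp : p.Prime) (k : ℕ) : ¬ p ∣ digitFacProd p k := by
  unfold digitFacProd
  rw [hp.prime.dvd_prod_iff]
  rintro ⟨a, ha, hpa⟩
  obtain ⟨d, hd, rfl⟩ := List.mem_map.mp ha
  exact absurd (hp.dvd_factorial.mp hpa) (not_le.mpr (Nat.digits_lt_base hp.one_lt hd))

end Digits

section LeadingTerm

variable {R F : Type*} [CommRing R] [Field F]

/-- After inverting elements outside the kernel of `π`, the element `x` is `l ^ s` times an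
element that reduces to `c`. -/
def HasLeadingTerm (π : R →+* F) (l x : R) (c : F) (s : ℕ) : Prop :=
  ∃ u v : R, π u ≠ 0 ∧ u * x = l ^ s * v ∧ π v = c * π u

variable {π : R →+* F} {l x y : R} {c d : F} {s t : ℕ}

lemma HasLeadingTerm.of_eq (h : x = l ^ s * y) (hy : π y = c) : HasLeadingTerm π l x c s :=
  ⟨1, y, by simp, by rw [one_mul, h], by simp [hy]⟩

lemma HasLeadingTerm.mul (hx : HasLeadingTerm π l x c s) (hy : HasLeadingTerm π l y d t) :
    HasLeadingTerm π l (x * y) (c * d) (s + t) := by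
  obtain ⟨u, v, hu, h, hv⟩ := hx
  obtain ⟨u', v', hu', h', hv'⟩ := hy
  refine ⟨u * u', v * v', by simp [hu, hu'], ?_, by rw [map_mul, map_mul, hv, hv']; ring⟩
  linear_combination (u' * y) * h + l ^ s * v * h'

lemma HasLeadingTerm.pow (hx : HasLeadingTerm π l x c s) (m : ℕ) :
    HasLeadingTerm π l (x ^ m) (c ^ m) (m * s) := by
  induction m with
  | zero => exact .of_eq (y := 1) (by simp) (by simp)
  | succ m ih =>
    rw [pow_succ, pow_succ, Nat.succ_mul]
    exact ih.mul hx

lemma HasLeadingTerm.of_mul_right (hx : HasLeadingTerm π l (x * y) c s) (hy : π y ≠ 0) :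
    HasLeadingTerm π l x (c / π y) s := by
  obtain ⟨u, v, hu, h, hv⟩ := hx
  refine ⟨u * y, v, by simp [hu, hy], by rw [← h]; ring, ?_⟩
  rw [hv, map_mul]
  field_simp

lemma HasLeadingTerm.le [IsDomain R] (hl : π l = 0) (hl0 : l ≠ 0) (hx : HasLeadingTerm π l x c s)
    (hy : HasLeadingTerm π l x d t) (hc : c ≠ 0) : t ≤ s := by
  by_contra! hst
  obtain ⟨u, v, hu, h, hv⟩ := hx
  obtain ⟨u', v', hu', h', hv'⟩ := hy
  obtain ⟨e, rfl⟩ := Nat.exists_eq_add_of_lt hst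
  have h₁ : u' * v = l * (l ^ e * v' * u) := by
    apply mul_left_cancel₀ (pow_ne_zero s hl0)
    linear_combination u * h' - u' * h
  have h₂ := congrArg π h₁
  rw [map_mul, map_mul, hl, zero_mul, hv] at h₂
  simp_all

lemma HasLeadingTerm.unique [IsDomain R] (hl : π l = 0) (hl0 : l ≠ 0) (hx : HasLeadingTerm π l x c s)
    (hy : HasLeadingTerm π l x d t) (hc : c ≠ 0) (hd : d ≠ 0) : c = d := by
  obtain rfl : s = t := le_antisymm (hy.le hl hl0 hx hd) (hx.le hl hl0 hy hc)
  obtain ⟨u, v, hu, h, hv⟩ := hx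
  obtain ⟨u', v', hu', h', hv'⟩ := hy
  have h₁ : u' * v = u * v' := by
    apply mul_left_cancel₀ (pow_ne_zero s hl0)
    linear_combination u * h' - u' * h
  have h₂ := congrArg π h₁
  rw [map_mul, map_mul, hv, hv'] at h₂
  apply mul_right_cancel₀ (mul_ne_zero hu hu')
  linear_combination h₂

end LeadingTerm

section FiniteFieldSums

variable {F : Type*} [Field F] [Fintype F]

lemma sum_inv_mul_pow (h3 : 3 ≤ Fintype.card F) {j : ℕ} (hj : j < Fintype.card F) :
    ∑ x : F, x⁻¹ * x ^ j = if j = 1 then -1 else 0 := by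
  classical
  have hsum : ∀ x : F, j ≠ 0 → x⁻¹ * x ^ j = x ^ (j - 1) - if j = 1 ∧ x = 0 then 1 else 0 := by
    intro x hj0
    obtain ⟨i, rfl⟩ := Nat.exists_eq_succ_of_ne_zero hj0
    by_cases hx : x = 0
    · by_cases hi : i = 0 <;> simp [hx, hi]
    · simp [hx, pow_succ']
  rcases eq_or_ne j 0 with rfl | hj0
  · have h := FiniteField.sum_pow_lt_card_sub_one F 1 (by omega)
    simp only [pow_one] at h
    simpa using (Equiv.sum_comp (Equiv.inv F) (fun x => x)).trans h
  · rw [Finset.sum_congr rfl fun x _ => hsum x hj0, Finset.sum_sub_distrib,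
      FiniteField.sum_pow_lt_card_sub_one F (j - 1) (by omega)]
    split_ifs with h <;> simp [h]

lemma sum_inv_mul_one_sub_pow (h3 : 3 ≤ Fintype.card F) {m : ℕ} (hm : m < Fintype.card F) :
    ∑ x : F, x⁻¹ * (1 - x) ^ m = m := by
  have h (x : F) : x⁻¹ * (1 - x) ^ m =
      ∑ j ∈ Finset.range (m + 1), (-1) ^ j * (m.choose j : F) * (x⁻¹ * x ^ j) := by
    rw [sub_eq_neg_add, add_pow, Finset.mul_sum]
    refine Finset.sum_congr rfl fun j _ => ?_
    rw [neg_pow x, one_pow]; ring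
  simp_rw [h]
  rw [Finset.sum_comm]
  simp_rw [← Finset.mul_sum]
  rw [Finset.sum_congr rfl fun j hj => by
    rw [sum_inv_mul_pow h3 (j := j) (by have := Finset.mem_range.mp hj; omega)]]
  rcases m.eq_zero_or_pos with rfl | hm0
  · simp
  · rw [Finset.sum_eq_single 1]
    · simp
    · intro b _ hb; simp [hb]
    · intro hb; exact absurd (Finset.mem_range.mpr (by omega)) hb

lemma sum_inv_mul_trace (p : ℕ) [Fact p.Prime] [Algebra (ZMod p) F]
    (h3 : 3 ≤ Fintype.card F) :
    ∑ x : F, x⁻¹ * algebraMap (ZMod p) F (Algebra.trace (ZMod p) F x) = -1 := by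
  have hp : p.Prime := Fact.out
  have hcard : Fintype.card F = p ^ Module.finrank (ZMod p) F := by
    rw [Module.card_eq_pow_finrank (K := ZMod p), ZMod.card]
  simp_rw [FiniteField.algebraMap_trace_eq_sum_pow, Finset.mul_sum]
  rw [Finset.sum_comm, Finset.sum_eq_single 0]
  · simpa using sum_inv_mul_pow (F := F) h3 (j := 1) (by omega)
  · intro i hi hi0
    have hlt : p ^ i < Fintype.card F :=
      hcard ▸ Nat.pow_lt_pow_right hp.one_lt (Finset.mem_range.mp hi)
    have hne : p ^ i ≠ 1 := by
      rw [Ne, Nat.pow_eq_one]; exact not_or.mpr ⟨hp.one_lt.ne', hi0⟩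
    rw [Nat.card_zmod, sum_inv_mul_pow h3 hlt, if_neg hne]
  · intro h
    exact absurd (Finset.mem_range.mpr Module.finrank_pos) h

lemma inv_pow_eq_pow_card_sub {m : ℕ} (hm0 : 0 < m) (hm : m < Fintype.card F - 1) (x : F) :
    x⁻¹ ^ m = x ^ (Fintype.card F - 1 - m) := by
  rcases eq_or_ne x 0 with rfl | hx
  · rw [inv_zero, zero_pow (by omega), zero_pow (by omega)]
  · rw [inv_pow, inv_eq_iff_eq_inv]
    apply eq_inv_of_mul_eq_one_left
    rw [← pow_add, Nat.add_sub_cancel' hm.le, FiniteField.pow_card_sub_one_eq_one x hx]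

end FiniteFieldSums

section Stickelberger

variable {R F : Type*} [CommRing R] [Field F]

/-- The additive character `x ↦ ζ ^ Tr(x)` of a finite field. -/
noncomputable def traceChar (F : Type*) [Field F] (p : ℕ) [Fact p.Prime]
    [Algebra (ZMod p) F] {ζ : R} (hζ : ζ ^ p = 1) : AddChar F R :=
  (AddChar.zmodChar p hζ).compAddMonoidHom (Algebra.trace (ZMod p) F).toAddMonoidHom

lemma traceChar_apply (p : ℕ) [Fact p.Prime] [Algebra (ZMod p) F] {ζ : R} (hζ : ζ ^ p = 1)
    (x : F) : traceChar F p hζ x = ζ ^ (Algebra.trace (ZMod p) F x).val := rfl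

variable {π : R →+* F} {ω : MulChar F R}

lemma map_inv_pow_apply (hω : ∀ x, π (ω x) = x) {k : ℕ} (hk : k ≠ 0) (x : F) :
    π ((ω⁻¹ ^ k) x) = x⁻¹ ^ k := by
  rw [MulChar.pow_apply' _ hk, map_pow, MulChar.inv_apply', hω]

lemma map_root_eq_one (p : ℕ) [Fact p.Prime] [Algebra (ZMod p) F] {ζ : R} (hζ : ζ ^ p = 1) :
    π ζ = 1 := by
  have : CharP F p := charP_of_injective_algebraMap' (ZMod p) p
  apply frobenius_inj F p
  rw [frobenius_def, frobenius_def, ← map_pow, hζ, map_one, one_pow]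

lemma hasLeadingTerm_prime [IsDomain R] (p : ℕ) [Fact p.Prime] [Algebra (ZMod p) F] {ζ : R}
    (hζ : IsPrimitiveRoot ζ p) (hodd : Odd p) :
    HasLeadingTerm π (ζ - 1) (p : R) (-1) (p - 1) := by
  have hp : p.Prime := Fact.out
  obtain ⟨n, rfl⟩ : ∃ n, p = n + 1 := ⟨p - 1, by have := hp.pos; omega⟩
  have heven : Even n := by
    rcases n.even_or_odd with h | h
    · exact h
    · exact absurd (h.add_odd odd_one) (Nat.not_even_iff_odd.mpr hodd)
  refine .of_eq (y := ∏ k ∈ Finset.range n, ∑ i ∈ Finset.range (k + 1), ζ ^ i) ?_ ?_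
  · have h := hζ.prod_pow_sub_one_eq_order
    rw [heven.neg_one_pow, one_mul] at h
    push_cast
    simp only [← h, ← mul_geom_sum, Finset.prod_mul_distrib,
      Finset.prod_const, Finset.card_range]
  · simp_rw [map_prod, map_sum, map_pow, map_root_eq_one (π := π) (n + 1) hζ.pow_eq_one,
      one_pow, Finset.sum_const, Finset.card_range, nsmul_one]
    have hw := congrArg (algebraMap (ZMod (n + 1)) F) (ZMod.wilsons_lemma (n + 1))
    rw [map_natCast, map_neg, map_one, Nat.add_sub_cancel] at hw
    rw [← hw, ← Finset.prod_range_add_one_eq_factorial, Nat.cast_prod]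

variable [Fintype F]

lemma traceChar_pow (p : ℕ) [Fact p.Prime] [Algebra (ZMod p) F] {ζ : R} (hζ : ζ ^ p = 1)
    (x : F) : traceChar F p hζ (x ^ p) = traceChar F p hζ x := by
  have h := Algebra.trace_eq_of_algEquiv
    (FiniteField.frobeniusAlgEquivOfAlgebraic (ZMod p) F) x
  rw [FiniteField.coe_frobeniusAlgEquivOfAlgebraic, ZMod.card] at h
  rw [traceChar_apply, traceChar_apply, h]

lemma inv_pow_ne_one (hω : ∀ x, π (ω x) = x) {k : ℕ} (hk : 0 < k)
    (hk' : k < Fintype.card F - 1) : ω⁻¹ ^ k ≠ 1 := by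
  intro h
  refine absurd (Nat.le_of_dvd hk ((FiniteField.forall_pow_eq_one_iff F k).mp fun x => ?_))
    (not_le.mpr hk')
  have h₁ := map_inv_pow_apply hω hk.ne' (x : F)
  rw [h, MulChar.one_apply_coe, map_one] at h₁
  ext
  rw [inv_pow, eq_comm, inv_eq_one] at h₁
  simpa using h₁

lemma map_jacobiSum (hω : ∀ x, π (ω x) = x) (h3 : 3 ≤ Fintype.card F) {k : ℕ} (hk : 0 < k)
    (hk' : k + 1 < Fintype.card F) : π (jacobiSum ω⁻¹ (ω⁻¹ ^ k)) = -(k + 1 : ℕ) := by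
  have h (x : F) : π (ω⁻¹ x * (ω⁻¹ ^ k) (1 - x)) =
      x⁻¹ * (1 - x) ^ (Fintype.card F - 1 - k) := by
    rw [map_mul, map_inv_pow_apply hω hk.ne', inv_pow_eq_pow_card_sub hk (by omega),
      MulChar.inv_apply', hω]
  rw [jacobiSum, map_sum, Finset.sum_congr rfl fun x _ => h x,
    sum_inv_mul_one_sub_pow h3 (by omega), Nat.sub_sub, Nat.cast_sub (by omega),
    FiniteField.cast_card_eq_zero, zero_sub, add_comm 1 k]

lemma gaussSum_pow_char (p : ℕ) [Fact p.Prime] [Algebra (ZMod p) F] {ζ : R} (hζ : ζ ^ p = 1)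
    (χ : MulChar F R) :
    gaussSum (χ ^ p) (traceChar F p hζ) = gaussSum χ (traceChar F p hζ) := by
  have : CharP F p := charP_of_injective_algebraMap' (ZMod p) p
  have hp : p.Prime := Fact.out
  unfold gaussSum
  refine Fintype.sum_bijective (frobenius F p)
    (Finite.injective_iff_bijective.mp (frobenius_inj F p)) _ _ fun x => ?_
  rw [frobenius_def, map_pow, MulChar.pow_apply' _ hp.ne_zero, traceChar_pow]

variable [IsDomain R]

lemma hasLeadingTerm_gaussSum_inv (p : ℕ) [Fact p.Prime] [Algebra (ZMod p) F]
    (hω : ∀ x, π (ω x) = x) (h3 : 3 ≤ Fintype.card F) {ζ : R} (hζ : ζ ^ p = 1) :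
    HasLeadingTerm π (ζ - 1) (gaussSum ω⁻¹ (traceChar F p hζ)) (-1) 1 := by
  have h1 : ω⁻¹ ≠ 1 := by
    simpa using inv_pow_ne_one hω one_pos (by omega)
  refine .of_eq (y := ∑ x : F, ω⁻¹ x *
    ∑ i ∈ Finset.range (Algebra.trace (ZMod p) F x).val, ζ ^ i) ?_ ?_
  · have h (x : F) : ω⁻¹ x * traceChar F p hζ x = ω⁻¹ x + (ζ - 1) * (ω⁻¹ x *
        ∑ i ∈ Finset.range (Algebra.trace (ZMod p) F x).val, ζ ^ i) := by
      rw [traceChar_apply]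
      linear_combination -(ω⁻¹ x) * mul_geom_sum ζ (Algebra.trace (ZMod p) F x).val
    rw [gaussSum, Finset.sum_congr rfl fun x _ => h x, Finset.sum_add_distrib,
      MulChar.sum_eq_zero_of_ne_one h1, ← Finset.mul_sum, zero_add, pow_one]
  · rw [← sum_inv_mul_trace (F := F) p h3, map_sum]
    refine Finset.sum_congr rfl fun x _ => ?_
    rw [map_mul, MulChar.inv_apply', hω, map_sum]
    simp_rw [map_pow, map_root_eq_one (π := π) p hζ, one_pow]
    rw [Finset.sum_const, Finset.card_range, nsmul_one,
      ← map_natCast (algebraMap (ZMod p) F), ZMod.natCast_zmod_val]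

/-- **Stickelberger's congruence** for Gauss sums. -/
theorem hasLeadingTerm_gaussSum (p : ℕ) [Fact p.Prime] [Algebra (ZMod p) F]
    (hω : ∀ x, π (ω x) = x) (h3 : 3 ≤ Fintype.card F) {ζ : R} (hζ : ζ ^ p = 1)
    (k : ℕ) (hk : 0 < k) (hk' : k < Fintype.card F - 1) :
    HasLeadingTerm π (ζ - 1) (gaussSum (ω⁻¹ ^ k) (traceChar F p hζ))
      (-(digitFacProd p k : F)⁻¹) (digitSum p k) := by
  have hp : p.Prime := Fact.out
  have : CharP F p := charP_of_injective_algebraMap' (ZMod p) p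
  have hp1 := hp.one_lt
  induction k using Nat.strong_induction_on with
  | _ k ih =>
  by_cases hpk : p ∣ k
  · obtain ⟨m, rfl⟩ := hpk
    have hm : 0 < m := Nat.pos_of_mul_pos_left hk
    have hmlt : m < p * m := by nlinarith
    have hS := digitSum_add_mul hp1 hp.pos m
    have ht := digitFacProd_add_mul hp1 hp.pos m
    simp only [zero_add, Nat.factorial_zero, one_mul] at hS ht
    rw [hS, ht, mul_comm p m, pow_mul, gaussSum_pow_char]
    exact ih m hmlt hm (by omega)
  · obtain ⟨r, m, hr, rfl⟩ : ∃ r m, r + 1 < p ∧ k = r + 1 + p * m := by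
      have h0 : k % p ≠ 0 := fun h => hpk (Nat.dvd_of_mod_eq_zero h)
      have h1 := Nat.mod_lt k hp.pos
      have h2 := Nat.mod_add_div k p
      exact ⟨k % p - 1, k / p, by omega, by omega⟩
    have hrF : ((r + 1 : ℕ) : F) ≠ 0 := by
      rw [Ne, CharP.cast_eq_zero_iff F p]
      exact Nat.not_dvd_of_pos_of_lt r.succ_pos hr
    rcases Nat.eq_zero_or_pos (r + p * m) with h0 | h0
    · have h1 : r + 1 + p * m = 1 := by omega
      rw [h1, pow_one]
      have hS := digitSum_add_mul hp1 hp1 0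
      have ht := digitFacProd_add_mul hp1 hp1 0
      have := hasLeadingTerm_gaussSum_inv p hω h3 hζ
      simp only [mul_zero, add_zero] at hS ht
      rw [hS, ht]
      simpa [digitSum, digitFacProd] using this
    · have hJ : π (jacobiSum ω⁻¹ (ω⁻¹ ^ (r + p * m))) = -((r + 1 : ℕ) : F) := by
        rw [map_jacobiSum hω h3 h0 (by omega)]
        push_cast
        rw [CharP.cast_eq_zero F p]; ring
      have hne : ω⁻¹ * ω⁻¹ ^ (r + p * m) ≠ 1 := by
        rw [← pow_succ', show r + p * m + 1 = r + 1 + p * m by ring]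
        exact inv_pow_ne_one hω hk hk'
      have h := (hasLeadingTerm_gaussSum_inv p hω h3 hζ).mul
        (ih (r + p * m) (by omega) h0 (by omega))
      rw [← jacobiSum_mul_nontrivial hne] at h
      have h' := h.of_mul_right (by rw [hJ]; exact neg_ne_zero.mpr hrF)
      rw [hJ, ← pow_succ', show r + p * m + 1 = r + 1 + p * m by ring,
        digitSum_add_mul hp1 (by omega), digitFacProd_add_mul hp1 (by omega)] at h'
      rw [digitSum_add_mul hp1 hr, digitFacProd_add_mul hp1 hr, Nat.factorial_succ]
      convert h' using 1
      · push_cast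
        rw [mul_inv, mul_inv, mul_inv]
        push_cast at hrF
        field_simp
      · ring

end Stickelberger

section Teichmuller

variable {R F : Type*} [CommRing R] [IsDomain R] [Field F] [Fintype F]

lemma eq_teichmuller_of_pow_eq_one {π : R →+* F} {ω : F → R}
    (hroot : ∀ t, t ≠ 0 → ω t ^ (Fintype.card F - 1) = 1) (hlift : ∀ t, π (ω t) = t)
    {z : R} (hz : z ^ (Fintype.card F - 1) = 1) : ω (π z) = z := by
  classical
  have hq : 0 < Fintype.card F - 1 := by have := Fintype.one_lt_card (α := F); omega
  have hinj : Function.Injective ω := fun a b h => by rw [← hlift a, h, hlift]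
  have hsub : (Finset.univ.erase (0 : F)).image ω ⊆
      Polynomial.nthRootsFinset (Fintype.card F - 1) (1 : R) := by
    intro y hy
    obtain ⟨t, ht, rfl⟩ := Finset.mem_image.mp hy
    exact (Polynomial.mem_nthRootsFinset hq 1).mpr (hroot t (Finset.ne_of_mem_erase ht))
  have heq := Finset.eq_of_subset_of_card_le hsub (by
    rw [Finset.card_image_of_injective _ hinj, Finset.card_erase_of_mem (Finset.mem_univ _),
      Finset.card_univ, Polynomial.nthRootsFinset]
    exact (Multiset.toFinset_card_le _).trans (Polynomial.card_nthRoots _ _))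
  have hmem := (Polynomial.mem_nthRootsFinset hq (1 : R)).mpr hz
  rw [← heq] at hmem
  obtain ⟨t, -, rfl⟩ := Finset.mem_image.mp hmem
  rw [hlift]

/-- A Teichmüller section, as a multiplicative character. -/
def teichmullerChar (π : R →+* F) (ω : F → R) (h0 : ω 0 = 0)
    (hroot : ∀ t, t ≠ 0 → ω t ^ (Fintype.card F - 1) = 1) (hlift : ∀ t, π (ω t) = t) :
    MulChar F R where
  toFun := ω
  map_one' := by
    simpa using eq_teichmuller_of_pow_eq_one hroot hlift (one_pow (Fintype.card F - 1))
  map_mul' x y := by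
    rcases eq_or_ne x 0 with rfl | hx
    · simp [h0]
    rcases eq_or_ne y 0 with rfl | hy
    · simp [h0]
    have := eq_teichmuller_of_pow_eq_one hroot hlift (z := ω x * ω y)
      (by rw [mul_pow, hroot x hx, hroot y hy, one_mul])
    rwa [map_mul, hlift, hlift] at this
  map_nonunit' x hx := by
    rw [isUnit_iff_ne_zero, not_not] at hx
    rw [hx, h0]

end Teichmuller

lemma sign_of_gaussSum_eq {R F : Type*} [CommRing R] [IsDomain R] [Field F] [Fintype F]
    [DecidableEq F] (p : ℕ) [Fact p.Prime] [Algebra (ZMod p) F] (hodd : Odd p) {ζ : R}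
    (hζ : IsPrimitiveRoot ζ p) (π : R →+* F) (ω : F → R) (hω0 : ω 0 = 0)
    (hroot : ∀ t, t ≠ 0 → ω t ^ (Fintype.card F - 1) = 1) (hlift : ∀ t, π (ω t) = t)
    {n : ℕ} (hn : 0 < n) (hn' : n < Fintype.card F - 1) {ε : R} (hε : IsUnit ε) (m : ℕ)
    (hG : ∑ x : F with x ≠ 0, ω x ^ n * ζ ^ (Algebra.trace (ZMod p) F x).val = ε * p ^ m) :
    (digitFacProd p (Fintype.card F - 1 - n) : F) * π ε = (-1) ^ (m + 1) := by
  have hp : p.Prime := Fact.out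
  have : CharP F p := charP_of_injective_algebraMap' (ZMod p) p
  set Ω := teichmullerChar π ω hω0 hroot hlift
  have hΩapp (x : F) : Ω x = ω x := rfl
  set k := Fintype.card F - 1 - n with hk
  have hgauss : gaussSum (Ω⁻¹ ^ k) (traceChar F p hζ.pow_eq_one) = ε * p ^ m := by
    rw [← hG, gaussSum, Finset.sum_filter]
    refine Finset.sum_congr rfl fun x _ => ?_
    rw [traceChar_apply]
    split_ifs with hx
    · congr 1
      have h1 : ω x ^ k * ω x ^ n = 1 := by
        rw [← pow_add, hk, Nat.sub_add_cancel hn'.le, hroot x hx]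
      have h2 : Ω⁻¹ x * ω x = 1 := by
        rw [← hΩapp, ← MulChar.mul_apply, inv_mul_cancel,
          MulChar.one_apply (isUnit_iff_ne_zero.mpr hx)]
      have h3 : Ω⁻¹ x ^ k * ω x ^ k = 1 := by rw [← mul_pow, h2, one_pow]
      rw [MulChar.pow_apply' _ (by omega)]
      linear_combination ω x ^ n * h3 - Ω⁻¹ x ^ k * h1
    · rw [not_not.mp hx, MulChar.map_zero, zero_mul]
  have ht : (digitFacProd p k : F) ≠ 0 := by
    rw [Ne, CharP.cast_eq_zero_iff F p]
    exact not_dvd_digitFacProd hp k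
  have hπε : π ε ≠ 0 := (hε.map π).ne_zero
  have h₁ := hasLeadingTerm_gaussSum p (ω := Ω) hlift (by omega) hζ.pow_eq_one k (by omega)
    (by omega)
  rw [hgauss] at h₁
  have h₂ := (HasLeadingTerm.of_eq (s := 0) (l := ζ - 1) (x := ε) (y := ε) (π := π)
    (by simp) rfl).mul ((hasLeadingTerm_prime (π := π) p hζ hodd).pow m)
  have h := h₁.unique (by rw [map_sub, map_root_eq_one p hζ.pow_eq_one, map_one, sub_self])
    (sub_ne_zero.mpr (hζ.ne_one hp.one_lt)) h₂ (by simp [ht])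
    (mul_ne_zero hπε (pow_ne_zero _ (by simp)))
  have hsq : ((-1 : F) ^ m) * (-1) ^ m = 1 := by rw [← mul_pow]; simp
  have h' : (digitFacProd p k : F) * (π ε * (-1) ^ m) = -1 := by
    rw [← h, mul_neg, mul_inv_cancel₀ ht]
  rw [pow_succ]
  linear_combination (-1 : F) ^ m * h' - (digitFacProd p k : F) * π ε * hsq

/-- **Sign determination in the index 2 case, form (1): `G(χ) = ε·p^(f/2)`.**
Let `p` be an odd prime, `N ≥ 2` with `gcd(N,p) = 1`, `f` the order of `p` mod `N`
(assumed even), `q = p^f`, `n = (q−1)/N`.  Let `E = ℚ(ζ_{q−1}, ζ_p)`, `𝔓` the prime of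
`𝓞 E` above `p` with residue field `F_q`, `ω` the Teichmüller map, `χ = ω^n` and
`G(χ) = ∑_{x ≠ 0} ω(x)^n ζp^{T(x)}` the Gauss sum.  If `G(χ) = ε·p^(f/2)` for some
root of unity `ε`, then `t(−n)·ε ≡ (−1)^(f/2+1) (mod 𝔓)`, where `−n ≡ q−1−n (mod q−1)`. -/
theorem sign_determination_index_two_form_one
    (p N f q n : ℕ) (hp : p.Prime) (hodd : Odd p)
    (hN : 2 ≤ N) (hNp : Nat.Coprime N p)
    (hf : orderOf (p : ZMod N) = f) (hq : q = p ^ f) (hn : n = (q - 1) / N)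
    (hfeven : 2 ∣ f)
    (E : Type) [Field E] [NumberField E]
    (ζ ζp : 𝓞 E)
    (hζ : IsPrimitiveRoot ζ (q - 1)) (hζp : IsPrimitiveRoot ζp p)
    (hgen : Algebra.adjoin ℚ {(ζ : E), (ζp : E)} = ⊤)
    (𝔓 : Ideal (𝓞 E)) (hprime : 𝔓.IsPrime) (hp𝔓 : (p : 𝓞 E) ∈ 𝔓)
    [Fintype (𝓞 E ⧸ 𝔓)] [DecidableEq (𝓞 E ⧸ 𝔓)]
    (hcard : Fintype.card (𝓞 E ⧸ 𝔓) = q)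
    [Algebra (ZMod p) (𝓞 E ⧸ 𝔓)]
    (ω : (𝓞 E ⧸ 𝔓) → 𝓞 E)
    (hω0 : ω 0 = 0)
    (hωroot : ∀ t : 𝓞 E ⧸ 𝔓, t ≠ 0 → ω t ^ (q - 1) = 1)
    (hωlift : ∀ t : 𝓞 E ⧸ 𝔓, Ideal.Quotient.mk 𝔓 (ω t) = t)
    (ε : 𝓞 E) (hε : ∃ m : ℕ, 0 < m ∧ ε ^ m = 1)
    (hG : (∑ x ∈ Finset.univ.filter (fun x : 𝓞 E ⧸ 𝔓 => x ≠ 0),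
        ω x ^ n * ζp ^ (Algebra.trace (ZMod p) (𝓞 E ⧸ 𝔓) x).val)
      = ε * (p : 𝓞 E) ^ (f / 2)) :
    (digitFacProd p (q - 1 - n) : 𝓞 E) * ε - (-1) ^ (f / 2 + 1) ∈ 𝔓 := by
  have : Fact p.Prime := ⟨hp⟩
  have hmax : 𝔓.IsMaximal := Ideal.Quotient.maximal_of_isField 𝔓
    (Finite.isField_of_domain (𝓞 E ⧸ 𝔓))
  let : Field (𝓞 E ⧸ 𝔓) := Ideal.Quotient.field 𝔓
  have hNq : N ∣ q - 1 := by
    rw [← Nat.modEq_iff_dvd' (hq ▸ Nat.one_le_pow _ _ hp.pos), ← ZMod.natCast_eq_natCast_iff,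
      hq, ← hf]
    push_cast
    exact (pow_orderOf_eq_one _).symm
  have hq1 : 1 < q := hcard ▸ Fintype.one_lt_card
  have hn0 : 0 < n := hn ▸ Nat.div_pos (Nat.le_of_dvd (by omega) hNq) (by omega)
  have hnq : n < q - 1 := hn ▸ Nat.div_lt_self (by omega) hN
  obtain ⟨m, hm, hεm⟩ := hε
  subst hcard
  have h := sign_of_gaussSum_eq p hodd hζp (Ideal.Quotient.mk 𝔓) ω hω0 hωroot hωlift hn0 hnq
    (IsUnit.of_pow_eq_one hεm hm.ne') (f / 2) hG
  rw [← Ideal.Quotient.eq, map_mul, map_pow, map_neg, map_one, map_natCast]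
  exact h
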